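/- With the notation of the context, let in addition a' > 0 and b' be real numbers, let m̃ : ℝ → ℝ be measurable, let j, j' ∈ ℤ, and assume that y ↦ m̃(y)·A_j^{a,b}(y)·B_{j'}^{a',b'}(y) and y ↦ m̃(y)·A_{j'}^{a',b'}(y)·B_j^{a,b}(y) are Lebesgue-integrable on ℝ. Then the matrix elements M^j_{j'}(a,b;a',b') := ∫_ℝ m̃(y)·A_j^{a,b}(y)·B_{j'}^{a',b'}(y) dy satisfy the exchange symmetry M^j_{j'}(a,b;a',b') = M^{j'}_{j}(a',b';a,b). -/

import Mathlib

open MeasureTheory Complex Real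

/-- The pole location `y_j = h(j+β) + iπ/γ`. -/
noncomputable def poleY (h β : ℝ) (γ : ℕ) (j : ℤ) : ℂ :=
  ((h * (j + β) : ℝ) : ℂ) + Complex.I * Real.pi / γ

/-- `A_j^{a,b}(y) = ∫ exp((N/2)·conj(y_j) + iω(conj(y_j)−y)) · exp(−ah(ω+ib)²) ·
(1 − exp((π/γ)(2ω−iN)))⁻¹ dω`. -/
noncomputable def Afun (h : ℝ) (N γ : ℕ) (β a b : ℝ) (j : ℤ) (y : ℝ) : ℂ :=
  ∫ ω : ℝ,
    Complex.exp ((N : ℂ) / 2 * (starRingEnd ℂ) (poleY h β γ j)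
        + Complex.I * ω * ((starRingEnd ℂ) (poleY h β γ j) - y))
      * Complex.exp (-(a * h) * ((ω : ℂ) + Complex.I * b) ^ 2)
      * (1 - Complex.exp (((Real.pi / γ : ℝ) : ℂ) * (2 * ω - Complex.I * N)))⁻¹

/-- `B_j^{a,b}(y) = ∫ exp((N/2)·y_j − iω(y_j−y)) · exp(−ah(ω−ib)²) ·
(1 − exp((π/γ)(2ω+iN)))⁻¹ dω`. -/
noncomputable def Bfun (h : ℝ) (N γ : ℕ) (β a b : ℝ) (j : ℤ) (y : ℝ) : ℂ :=
  ∫ ω : ℝ,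
    Complex.exp ((N : ℂ) / 2 * poleY h β γ j
        - Complex.I * ω * (poleY h β γ j - y))
      * Complex.exp (-(a * h) * ((ω : ℂ) - Complex.I * b) ^ 2)
      * (1 - Complex.exp (((Real.pi / γ : ℝ) : ℂ) * (2 * ω + Complex.I * N)))⁻¹

theorem exp_odd_aux (p : ℕ) (hp : Odd p) : Complex.exp (Complex.I * Real.pi * p) = -1 := by
  rw [show Complex.I * (Real.pi : ℂ) * p = (p : ℂ) * (Real.pi * Complex.I) by ring,
    Complex.exp_nat_mul, Complex.exp_pi_mul_I, hp.neg_one_pow]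

theorem Bfun_eq_neg_Afun (h : ℝ) (N γ : ℕ) (hγ : 0 < γ)
    (hodd : ∃ p : ℕ, Odd p ∧ N = γ * p) (β a b : ℝ) (j : ℤ) (y : ℝ) :
    Bfun h N γ β a b j y = -Afun h N γ β a b j y := by
  obtain ⟨p, hp, rfl⟩ := hodd
  unfold Bfun Afun
  rw [← integral_neg, ← integral_neg_eq_self]
  congr 1
  funext ω
  have hg : (γ : ℂ) ≠ 0 := by exact_mod_cast hγ.ne'
  have hE := exp_odd_aux p hp
  have hc : (starRingEnd ℂ) (poleY h β γ j)
      = poleY h β γ j - 2 * (Complex.I * Real.pi / γ) := by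
    simp only [poleY, map_add, map_div₀, map_mul, Complex.conj_ofReal, Complex.conj_I,
      map_natCast]
    ring
  rw [hc]
  generalize poleY h β γ j = z
  set t : ℝ := Real.exp (2 * Real.pi * ω / γ) with ht
  have htpos : 0 < t := Real.exp_pos _
  have htc : (t : ℂ) = Complex.exp (2 * Real.pi * ω / γ) := by
    rw [ht]; push_cast; rfl
  have htc0 : (t : ℂ) ≠ 0 := by exact_mod_cast htpos.ne'
  have ht1 : (1 : ℂ) + t ≠ 0 := by
    have : (1 : ℝ) + t ≠ 0 := by positivity
    exact_mod_cast this
  have ht2 : (t : ℂ) + 1 ≠ 0 := by rwa [add_comm]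
  have hE' : Complex.exp (-(Complex.I * Real.pi * p)) = -1 := by
    rw [Complex.exp_neg, hE]; norm_num
  have e1 : Complex.exp (((Real.pi / γ : ℝ) : ℂ) * (2 * ω - Complex.I * ((γ * p : ℕ) : ℂ)))
      = -t := by
    rw [show ((Real.pi / γ : ℝ) : ℂ) * (2 * ω - Complex.I * ((γ * p : ℕ) : ℂ))
      = 2 * Real.pi * ω / γ + -(Complex.I * Real.pi * p) by push_cast; field_simp; ring,
      Complex.exp_add, hE', htc]
    ring
  have e2 : Complex.exp (((Real.pi / γ : ℝ) : ℂ) *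
      (2 * ((-ω : ℝ) : ℂ) + Complex.I * ((γ * p : ℕ) : ℂ))) = -(t : ℂ)⁻¹ := by
    rw [show ((Real.pi / γ : ℝ) : ℂ) * (2 * ((-ω : ℝ) : ℂ) + Complex.I * ((γ * p : ℕ) : ℂ))
      = -(2 * Real.pi * ω / γ) + (Complex.I * Real.pi * p) by push_cast; field_simp,
      Complex.exp_add, hE, htc, Complex.exp_neg]
    ring
  have e3 : Complex.exp (((γ * p : ℕ) : ℂ) / 2 * (z - 2 * (Complex.I * Real.pi / γ))
        + Complex.I * ω * (z - 2 * (Complex.I * Real.pi / γ) - y))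
      = -(t * Complex.exp (((γ * p : ℕ) : ℂ) / 2 * z
        - Complex.I * ((-ω : ℝ) : ℂ) * (z - y))) := by
    rw [show ((γ * p : ℕ) : ℂ) / 2 * (z - 2 * (Complex.I * Real.pi / γ))
        + Complex.I * ω * (z - 2 * (Complex.I * Real.pi / γ) - y)
      = 2 * Real.pi * ω / γ + (((γ * p : ℕ) : ℂ) / 2 * z
        - Complex.I * ((-ω : ℝ) : ℂ) * (z - y)) + -(Complex.I * Real.pi * p) by
        push_cast; field_simp; ring_nf; simp only [Complex.I_sq]; ring,
      Complex.exp_add, Complex.exp_add, hE', htc]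
    ring
  have e4 : (((-ω : ℝ) : ℂ) - Complex.I * b) ^ 2 = ((ω : ℂ) + Complex.I * b) ^ 2 := by
    push_cast; ring
  rw [e1, e2, e3, e4]
  have e5 : (1 - -(t : ℂ)⁻¹)⁻¹ = t * (1 - -(t : ℂ))⁻¹ := by
    rw [sub_neg_eq_add, sub_neg_eq_add]
    field_simp
    ring
  rw [e5]
  ring

/-- The exchange symmetry `M^j_{j'}(a,b;a',b') = M^{j'}_{j}(a',b';a,b)` for the matrix
elements `M^j_{j'}(a,b;a',b') = ∫ m̃(y)·A_j^{a,b}(y)·B_{j'}^{a',b'}(y) dy`. -/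
theorem matrix_element_exchange_symmetry
    (h : ℝ) (hh : 0 < h) (N γ : ℕ) (hN : 0 < N) (hγ : 0 < γ)
    (hodd : ∃ p : ℕ, Odd p ∧ N = γ * p)
    (β : ℝ) (hβ : β = 0 ∨ β = 1 / 2)
    (a b a' b' : ℝ) (ha : 0 < a) (ha' : 0 < a')
    (mt : ℝ → ℝ) (hmt : Measurable mt)
    (j j' : ℤ)
    (hint : Integrable (fun y : ℝ =>
      ((mt y : ℝ) : ℂ) * Afun h N γ β a b j y * Bfun h N γ β a' b' j' y))
    (hint' : Integrable (fun y : ℝ =>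
      ((mt y : ℝ) : ℂ) * Afun h N γ β a' b' j' y * Bfun h N γ β a b j y)) :
    ∫ y : ℝ, ((mt y : ℝ) : ℂ) * Afun h N γ β a b j y * Bfun h N γ β a' b' j' y
      = ∫ y : ℝ, ((mt y : ℝ) : ℂ) * Afun h N γ β a' b' j' y * Bfun h N γ β a b j y := by
  congr 1
  funext y
  rw [Bfun_eq_neg_Afun h N γ hγ hodd, Bfun_eq_neg_Afun h N γ hγ hodd]
  ring
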